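/- arXiv:2004.14504 — 5 statements merged into one kernel-verified Lean document; each statement's English description precedes it below -/
import Mathlib

section
/- Let x₀ be a real diagonal d×d matrix with nonincreasing diagonal entries and let h₁, h₂ be unitary matrices with h₁ x₀ h₁* = h₂ x₀ h₂*. Then for every g ∈ GL(d,ℂ) one has k(g h₁) x₀ k(g h₁)* = k(g h₂) x₀ k(g h₂)*; consequently the assignment g·(h x₀ h*) := k(g h) x₀ k(g h)* is a well-defined action of GL(d,ℂ) on Hermitian matrices extending unitary conjugation. -/
open Matrix
open scoped ComplexOrder

noncomputable section
open scoped Classical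

/-- Square complex matrices of size `d`. -/
abbrev Mat (d : ℕ) := Matrix (Fin d) (Fin d) ℂ

/-- `n` is upper triangular with all diagonal entries equal to `1`. -/
def IsUnitUpperTriangular {d : ℕ} (n : Mat d) : Prop :=
  n.BlockTriangular (id : Fin d → Fin d) ∧ ∀ i, n i i = 1

/-- `a` is diagonal with positive real diagonal entries. -/
def IsPosDiagonal {d : ℕ} (a : Mat d) : Prop :=
  ∃ f : Fin d → ℝ, (∀ i, 0 < f i) ∧ a = Matrix.diagonal (fun i => (f i : ℂ))

/-- `(k, a, n)` is an Iwasawa (QR) decomposition of `g`: `g = k a n` with `k` unitary,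
`a` diagonal with positive real diagonal entries and `n` unit upper triangular. -/
def IsIwasawa {d : ℕ} (g k a n : Mat d) : Prop :=
  g = k * a * n ∧ k ∈ Matrix.unitaryGroup (Fin d) ℂ ∧ IsPosDiagonal a ∧ IsUnitUpperTriangular n

/-- A choice of the (unique) Iwasawa decomposition `(k(g), a(g), n(g))` of `g`. -/
def iwaTriple {d : ℕ} (g : Mat d) : Mat d × Mat d × Mat d :=
  if h : ∃ t : Mat d × Mat d × Mat d, IsIwasawa g t.1 t.2.1 t.2.2 then h.choose else (1, 1, 1)

/-- The unitary factor `k(g)` in the Iwasawa decomposition of `g`. -/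
def iwaK {d : ℕ} (g : Mat d) : Mat d := (iwaTriple g).1

/-- `α(g) = log a(g)`, a real diagonal matrix. -/
def iwaAlpha {d : ℕ} (g : Mat d) : Matrix (Fin d) (Fin d) ℝ :=
  Matrix.diagonal (fun i => Real.log (((iwaTriple g).2.1 i i).re))

/-- Every invertible matrix has an Iwasawa decomposition. -/
theorem exists_isIwasawa {d : ℕ} {M : Mat d} (hM : IsUnit M) :
    ∃ k a n : Mat d, IsIwasawa M k a n := by
  have hS : (Mᴴ * M).PosDef :=
    Matrix.PosDef.conjTranspose_mul_self M (Matrix.mulVec_injective_of_isUnit hM)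
  set L := LDL.lowerInv hS
  have hLunit : IsUnit L := isUnit_of_invertible _
  have hUunit : IsUnit Lᴴ := by simpa [← star_eq_conjTranspose] using hLunit.star
  have hUtri : Lᴴ.BlockTriangular (id : Fin d → Fin d) := fun i j hij => by
    have h : L j i = 0 := LDL.lowerInv_triangular hS hij
    rw [conjTranspose_apply, h, star_zero]
  have hD : (M * Lᴴ)ᴴ * (M * Lᴴ) = diagonal (LDL.diagEntries hS) := by
    rw [conjTranspose_mul, conjTranspose_conjTranspose]
    simpa [LDL.diag, Matrix.mul_assoc] using (LDL.diag_eq_lowerInv_conj hS).symm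
  have hDpos : ∀ i, 0 < LDL.diagEntries hS i := by
    rw [← posDef_diagonal_iff, ← hD]
    exact Matrix.PosDef.conjTranspose_mul_self _
      (Matrix.mulVec_injective_of_isUnit (hM.mul hUunit))
  set e : Fin d → ℝ := fun i => (LDL.diagEntries hS i).re
  have hepos : ∀ i, 0 < e i := fun i => (Complex.pos_iff.1 (hDpos i)).1
  have hDe : LDL.diagEntries hS = fun i => (e i : ℂ) := by
    funext i
    exact Complex.ext rfl (by simpa using (Complex.pos_iff.1 (hDpos i)).2.symm)
  rw [hDe] at hD
  obtain ⟨_⟩ := hUunit.nonempty_invertible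
  set W := (Lᴴ)⁻¹
  have hWtri : W.BlockTriangular (id : Fin d → Fin d) :=
    blockTriangular_inv_of_blockTriangular hUtri
  have hUW : Lᴴ * W = 1 := mul_inv_of_invertible _
  have hwne : ∀ i, W i i ≠ 0 := by
    have hdet : W.det ≠ 0 := fun h => by simpa [h] using congrArg det hUW
    rw [det_of_isUpperTriangular hWtri, Finset.prod_ne_zero_iff] at hdet
    exact fun i => hdet i (Finset.mem_univ i)
  set r : Fin d → ℝ := fun i => √(e i) * ‖W i i‖ with hr
  have hrpos : ∀ i, 0 < r i := fun i =>
    mul_pos (Real.sqrt_pos.2 (hepos i)) (norm_pos_iff.2 (hwne i))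
  have hrne : ∀ i, (r i : ℂ) ≠ 0 := fun i => Complex.ofReal_ne_zero.2 (hrpos i).ne'
  refine ⟨M * Lᴴ * diagonal (fun i => W i i / r i), diagonal (fun i => (r i : ℂ)),
    diagonal (fun i => (W i i)⁻¹) * W, ?_, ?_, ⟨r, hrpos, rfl⟩,
    (blockTriangular_diagonal _).mul hWtri, fun i => by simp [hwne i]⟩
  · have h : diagonal (fun i => W i i / r i) * diagonal (fun i => (r i : ℂ)) *
        diagonal (fun i => (W i i)⁻¹) = (1 : Mat d) := by
      simp [diagonal_mul_diagonal, hrne, hwne]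
    calc M = M * Lᴴ * 1 * W := by rw [Matrix.mul_one, Matrix.mul_assoc, hUW, Matrix.mul_one]
      _ = _ := by rw [← h]; simp only [Matrix.mul_assoc]
  · rw [mem_unitaryGroup_iff', star_eq_conjTranspose, conjTranspose_mul, Matrix.mul_assoc,
      ← Matrix.mul_assoc (M * Lᴴ)ᴴ, hD, diagonal_conjTranspose, diagonal_mul_diagonal,
      diagonal_mul_diagonal, ← diagonal_one]
    congr 1
    funext i
    have h : (r i : ℂ) * r i = e i * (star (W i i) * W i i) := by
      rw [Complex.star_def, Complex.conj_mul', hr]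
      norm_cast
      rw [mul_mul_mul_comm, Real.mul_self_sqrt (hepos i).le, sq]
    have hrr := hrne i
    simp only [Pi.star_apply, star_div₀, Complex.star_def, Complex.conj_ofReal] at h ⊢
    field_simp
    linear_combination -h

theorem isIwasawa_iwaTriple {d : ℕ} {M : Mat d} (hM : IsUnit M) :
    IsIwasawa M (iwaK M) (iwaTriple M).2.1 (iwaTriple M).2.2 := by
  have h : ∃ t : Mat d × Mat d × Mat d, IsIwasawa M t.1 t.2.1 t.2.2 := by
    obtain ⟨k, a, n, h⟩ := exists_isIwasawa hM
    exact ⟨(k, a, n), h⟩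
  rw [iwaK, iwaTriple, dif_pos h]
  exact h.choose_spec

/-- The unitary factor of an invertible matrix differs from it by an invertible upper triangular
matrix. -/
theorem exists_eq_iwaK_mul {d : ℕ} {M : Mat d} (hM : IsUnit M) :
    ∃ r : Mat d, IsUnit r ∧ r.BlockTriangular (id : Fin d → Fin d) ∧ M = iwaK M * r := by
  obtain ⟨h, -, ⟨f, -, ha⟩, hn⟩ := isIwasawa_iwaTriple hM
  refine ⟨(iwaTriple M).2.1 * (iwaTriple M).2.2, ?_, ?_, by rwa [← Matrix.mul_assoc]⟩
  · rw [h, Matrix.mul_assoc] at hM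
    rw [isUnit_iff_isUnit_det] at hM ⊢
    rw [det_mul] at hM
    exact isUnit_of_mul_isUnit_right hM
  · rw [ha]
    exact (blockTriangular_diagonal _).mul hn.1

theorem iwaK_mem_unitaryGroup {d : ℕ} {M : Mat d} (hM : IsUnit M) :
    iwaK M ∈ unitaryGroup (Fin d) ℂ :=
  (isIwasawa_iwaTriple hM).2.1

/-- An upper triangular matrix is block triangular for every monotone `b`. -/
theorem blockTriangular_of_monotone {d : ℕ} {α : Type*} [LinearOrder α] {M : Mat d}
    {b : Fin d → α} (hM : M.BlockTriangular (id : Fin d → Fin d)) (hb : Monotone b) :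
    M.BlockTriangular b :=
  fun _ _ hij => hM (hb.reflect_lt hij)

theorem commute_diagonal_iff {d : ℕ} {M : Mat d} {f : Fin d → ℝ} :
    Commute M (diagonal fun i => (f i : ℂ)) ↔ ∀ i j, f i ≠ f j → M i j = 0 := by
  rw [commute_iff_eq, ← Matrix.ext_iff]
  refine forall₂_congr fun i j => ?_
  rw [mul_diagonal, diagonal_mul, mul_comm, mul_eq_mul_right_iff, Complex.ofReal_inj,
    or_iff_not_imp_left, eq_comm]

/-- A unitary matrix that is block triangular for the level sets of `f` is block diagonal. -/
theorem commute_diagonal_of_blockTriangular {d : ℕ} {v : Mat d} {f : Fin d → ℝ}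
    (hv : v ∈ unitaryGroup (Fin d) ℂ) (htri : v.BlockTriangular (OrderDual.toDual ∘ f)) :
    Commute v (diagonal fun i => (f i : ℂ)) := by
  have hinv : v⁻¹ = star v := inv_eq_left_inv (mem_unitaryGroup_iff'.1 hv)
  have : Invertible v := invertibleOfLeftInverse v _ (mem_unitaryGroup_iff'.1 hv)
  have htri' := blockTriangular_inv_of_blockTriangular htri
  rw [hinv] at htri'
  refine commute_diagonal_iff.2 fun i j hij => ?_
  rcases hij.lt_or_gt with h | h
  · exact htri h
  · simpa [star_apply] using htri' (i := j) (j := i) h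

theorem stmt1 (d : ℕ) (hd : 1 ≤ d) (f : Fin d → ℝ) (hf : Antitone f)
    (h₁ h₂ : Mat d) (hh₁ : h₁ ∈ Matrix.unitaryGroup (Fin d) ℂ)
    (hh₂ : h₂ ∈ Matrix.unitaryGroup (Fin d) ℂ)
    (hx : h₁ * Matrix.diagonal (fun i => (f i : ℂ)) * star h₁
        = h₂ * Matrix.diagonal (fun i => (f i : ℂ)) * star h₂)
    (g : GL (Fin d) ℂ) :
    iwaK ((↑g : Mat d) * h₁) * Matrix.diagonal (fun i => (f i : ℂ)) * star (iwaK ((↑g : Mat d) * h₁))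
      = iwaK ((↑g : Mat d) * h₂) * Matrix.diagonal (fun i => (f i : ℂ)) *
          star (iwaK ((↑g : Mat d) * h₂)) := by
  have hg : IsUnit (g : Mat d) := g.isUnit
  have hM₁ : IsUnit ((g : Mat d) * h₁) := hg.mul (Unitary.isUnit_coe (U := ⟨h₁, hh₁⟩))
  have hM₂ : IsUnit ((g : Mat d) * h₂) := hg.mul (Unitary.isUnit_coe (U := ⟨h₂, hh₂⟩))
  obtain ⟨r₁, -, hr₁, hgr₁⟩ := exists_eq_iwaK_mul hM₁
  obtain ⟨r₂, hr₂u, hr₂, hgr₂⟩ := exists_eq_iwaK_mul hM₂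
  have hk₁ := iwaK_mem_unitaryGroup hM₁
  have hk₂ := iwaK_mem_unitaryGroup hM₂
  set k₁ := iwaK ((g : Mat d) * h₁)
  set k₂ := iwaK ((g : Mat d) * h₂)
  set x : Mat d := diagonal fun i => (f i : ℂ)
  have hb : Monotone (OrderDual.toDual ∘ f) := fun i j hij => hf hij
  have hu : Commute (star h₁ * h₂) x := by
    have e₁ := mem_unitaryGroup_iff'.1 hh₁
    have e₂ := mem_unitaryGroup_iff'.1 hh₂
    calc star h₁ * h₂ * x = star h₁ * (h₂ * x * star h₂) * h₂ := by
          simp only [Matrix.mul_assoc, e₂, Matrix.mul_one]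
      _ = star h₁ * h₁ * x * (star h₁ * h₂) := by
          rw [← hx]; simp only [Matrix.mul_assoc]
      _ = x * (star h₁ * h₂) := by rw [e₁, Matrix.one_mul]
  have hutri : (star h₁ * h₂).BlockTriangular (OrderDual.toDual ∘ f) := fun i j hij =>
    commute_diagonal_iff.1 hu i j (ne_of_lt hij : f i ≠ f j)
  obtain ⟨_⟩ := hr₂u.nonempty_invertible
  have hv : star k₁ * k₂ = r₁ * (star h₁ * h₂) * r₂⁻¹ := by
    have h : k₂ * r₂ = k₁ * r₁ * (star h₁ * h₂) := by
      rw [← hgr₁, ← hgr₂, Matrix.mul_assoc, ← Matrix.mul_assoc h₁,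
        mem_unitaryGroup_iff.1 hh₁, Matrix.one_mul]
    rw [← mul_inv_cancel_right_of_invertible r₂ k₂, h]
    simp only [← Matrix.mul_assoc]
    rw [mem_unitaryGroup_iff'.1 hk₁, Matrix.one_mul]
  have hvx : Commute (star k₁ * k₂) x := by
    refine commute_diagonal_of_blockTriangular (mul_mem (Unitary.star_mem hk₁) hk₂) ?_
    rw [hv]
    exact ((blockTriangular_of_monotone hr₁ hb).mul hutri).mul
      (blockTriangular_inv_of_blockTriangular (blockTriangular_of_monotone hr₂ hb))
  have e₁ := mem_unitaryGroup_iff.1 hk₁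
  have e₂ := mem_unitaryGroup_iff.1 hk₂
  calc k₁ * x * star k₁ = k₁ * (x * (star k₁ * k₂)) * star k₂ := by
        simp only [Matrix.mul_assoc, e₂, Matrix.mul_one]
    _ = k₁ * star k₁ * k₂ * x * star k₂ := by
        rw [← hvx.eq]; simp only [Matrix.mul_assoc]
    _ = k₂ * x * star k₂ := by rw [e₁, Matrix.one_mul]

end
end

section
/- Let x₀ be a real diagonal d×d matrix with nonincreasing diagonal entries, let g ∈ GL(d,ℂ), and let u be a unitary matrix with u x₀ u* = x₀. Then Tr(x₀ α(g)) = Tr(x₀ α(g u)). In particular, if h₁, h₂ are unitary with h₁ x₀ h₁* = h₂ x₀ h₂*, then Tr(x₀ α(g h₁)) = Tr(x₀ α(g h₂)). -/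
open Matrix
open scoped ComplexOrder

noncomputable section
open scoped Classical

/-- The Gram matrix of a matrix vanishing on the block `(¬ p, p)` determines the modulus of the
determinant of its `p`-block. -/
theorem norm_det_toBlock_eq_of_gram_eq {ι : Type*} [Fintype ι] [DecidableEq ι] (p : ι → Prop)
    {X Y : Matrix ι ι ℂ} (hX : ∀ i j, ¬ p i → p j → X i j = 0)
    (hY : ∀ i j, ¬ p i → p j → Y i j = 0) (h : Xᴴ * X = Yᴴ * Y) :
    ‖(X.toBlock p p).det‖ = ‖(Y.toBlock p p).det‖ := by
  have key : ∀ Z : Matrix ι ι ℂ, (∀ i j, ¬ p i → p j → Z i j = 0) →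
      ((Zᴴ * Z).toBlock p p).det = ((‖(Z.toBlock p p).det‖ ^ 2 : ℝ) : ℂ) := by
    intro Z hZ
    have h0 : Z.toBlock (fun i => ¬ p i) p = 0 := by
      ext i j
      exact hZ i j i.2 j.2
    have h1 : Zᴴ.toBlock p p = (Z.toBlock p p)ᴴ := rfl
    rw [toBlock_mul_eq_add p p, h0, Matrix.mul_zero, add_zero, h1, det_mul, det_conjTranspose,
      Complex.star_def, Complex.conj_mul']
    push_cast
    rfl
  have := (key X hX).symm.trans ((congrArg (fun Z => (Z.toBlock p p).det) h).trans (key Y hY))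
  exact (sq_eq_sq₀ (norm_nonneg _) (norm_nonneg _)).1 (Complex.ofReal_injective this)

/-- Every invertible matrix has an Iwasawa decomposition. -/
theorem exists_isIwasawa_s2 {d : ℕ} {g : Mat d} (hg : IsUnit g) :
    ∃ t : Mat d × Mat d × Mat d, IsIwasawa g t.1 t.2.1 t.2.2 := by
  let e := EuclideanSpace.basisFun (Fin d) ℂ
  let v : Fin d → EuclideanSpace ℂ (Fin d) := fun j => WithLp.toLp 2 (fun i => g i j)
  let b := InnerProductSpace.gramSchmidtOrthonormalBasis (𝕜 := ℂ) (by simp) v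
  let R : Mat d := b.toBasis.toMatrix v
  have hRt : R.BlockTriangular id :=
    InnerProductSpace.gramSchmidtOrthonormalBasis_inv_isUpperTriangular _ v
  let Q : Mat d := e.toBasis.toMatrix b
  have hQ : Q ∈ Matrix.unitaryGroup (Fin d) ℂ := e.toMatrix_orthonormalBasis_mem_unitary b
  have hgv : e.toBasis.toMatrix v = g := by
    ext i j
    simp [e, v, Module.Basis.toMatrix_apply]
  have hgQR : g = Q * R := by
    rw [← hgv]
    have := Module.Basis.toMatrix_mul_toMatrix e.toBasis b.toBasis v
    simpa [Q, R] using this.symm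
  have hR0 : ∀ i, R i i ≠ 0 := by
    have hdet : R.det ≠ 0 := by
      have := (Matrix.isUnit_iff_isUnit_det _).1 hg
      rw [hgQR, det_mul] at this
      exact right_ne_zero_of_mul this.ne_zero
    rw [det_of_isUpperTriangular hRt] at hdet
    exact fun i => Finset.prod_ne_zero_iff.1 hdet i (Finset.mem_univ i)
  have hn0 : ∀ i, (‖R i i‖ : ℂ) ≠ 0 := fun i => by simpa using hR0 i
  let P : Mat d := diagonal fun i => R i i / ‖R i i‖
  have hP : P ∈ Matrix.unitaryGroup (Fin d) ℂ := by
    rw [mem_unitaryGroup_iff, star_eq_conjTranspose, diagonal_conjTranspose, diagonal_mul_diagonal,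
      ← diagonal_one]
    congr 1
    ext i
    have := Complex.mul_conj' (R i i)
    simp only [Pi.star_apply, Complex.star_def, map_div₀, Complex.conj_ofReal]
    rw [div_mul_div_comm, this, ← sq, div_self (pow_ne_zero 2 (hn0 i))]
  refine ⟨(Q * P, diagonal fun i => ((‖R i i‖ : ℝ) : ℂ), diagonal (fun i => (R i i)⁻¹) * R),
    ?_, mul_mem hQ hP, ⟨_, fun i => norm_pos_iff.2 (hR0 i), rfl⟩, ?_, ?_⟩
  · have : P * (diagonal fun i => ((‖R i i‖ : ℝ) : ℂ)) * (diagonal fun i => (R i i)⁻¹) = 1 := by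
      rw [diagonal_mul_diagonal, diagonal_mul_diagonal, ← diagonal_one]
      congr 1
      ext i
      rw [div_mul_cancel₀ _ (hn0 i), mul_inv_cancel₀ (hR0 i)]
    calc g = Q * (P * (diagonal fun i => ((‖R i i‖ : ℝ) : ℂ)) * diagonal fun i => (R i i)⁻¹) * R := by
          rw [this, Matrix.mul_one, hgQR]
      _ = _ := by simp only [Matrix.mul_assoc]
  · exact (blockTriangular_diagonal _).mul hRt
  · intro i
    simp [diagonal_mul, hR0 i]

/-- The logarithms on the diagonal of `α(g)` are those of the diagonal of an upper triangular matrix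
with the same Gram matrix as `g`. -/
theorem exists_upperTriangular_gram_eq {d : ℕ} {g : Mat d} (hg : IsUnit g) :
    ∃ (R : Mat d) (a : Fin d → ℝ), R.BlockTriangular id ∧ (∀ i, 0 < a i) ∧
      (∀ i, R i i = a i) ∧ gᴴ * g = Rᴴ * R ∧
      iwaAlpha g = diagonal fun i => Real.log (a i) := by
  have hex := exists_isIwasawa_s2 hg
  have hspec : IsIwasawa g (iwaTriple g).1 (iwaTriple g).2.1 (iwaTriple g).2.2 := by
    rw [iwaTriple, dif_pos hex]
    exact hex.choose_spec
  obtain ⟨hg', hk, ⟨a, ha, haa⟩, hnt, hn1⟩ := hspec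
  refine ⟨(iwaTriple g).2.1 * (iwaTriple g).2.2, a, ?_, ha, ?_, ?_, ?_⟩
  · rw [haa]
    exact (blockTriangular_diagonal _).mul hnt
  · intro i
    rw [haa, diagonal_mul, hn1, mul_one]
  · have hk' : (iwaTriple g).1ᴴ * (iwaTriple g).1 = 1 := mem_unitaryGroup_iff'.1 hk
    generalize (iwaTriple g).1 = k at *
    generalize (iwaTriple g).2.1 = a at *
    generalize (iwaTriple g).2.2 = n at *
    subst hg'
    rw [Matrix.mul_assoc k, conjTranspose_mul, Matrix.mul_assoc, ← Matrix.mul_assoc kᴴ, hk',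
      Matrix.one_mul]
  · rw [iwaAlpha, haa]
    simp

/-- If `u` is unitary and preserves the coordinate subspace spanned by an initial segment `p`, then
the partial sums of the diagonals of `α(g)` and `α(g u)` over `p` agree. -/
theorem sum_iwaAlpha_mul_unitary {d : ℕ} {g u : Mat d} (hg : IsUnit g)
    (hu : u ∈ Matrix.unitaryGroup (Fin d) ℂ) (p : Fin d → Prop)
    (hp : ∀ i j, i ≤ j → p j → p i) (hup : ∀ i j, ¬ p i → p j → u i j = 0) :
    ∑ i with p i, iwaAlpha g i i = ∑ i with p i, iwaAlpha (g * u) i i := by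
  have hu' : uᴴ * u = 1 := mem_unitaryGroup_iff'.1 hu
  have hgu : IsUnit (g * u) := hg.mul (IsUnit.of_mul_eq_one_right uᴴ hu')
  obtain ⟨R, a, hR, ha, hRa, hgR, hα⟩ := exists_upperTriangular_gram_eq hg
  obtain ⟨R', a', hR', ha', hRa', hgR', hα'⟩ := exists_upperTriangular_gram_eq hgu
  have hz : ∀ T : Mat d, T.BlockTriangular id → ∀ i j, ¬ p i → p j → T i j = 0 :=
    fun T hT i j hi hj => hT (lt_of_not_ge fun hij => hi (hp i j hij hj))
  have hblock : (R * u).toBlock p p = R.toBlock p p * u.toBlock p p := by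
    have h0 : u.toBlock (fun i => ¬ p i) p = 0 := by
      ext i j
      exact hup i j i.2 j.2
    rw [toBlock_mul_eq_add p p, h0, Matrix.mul_zero, add_zero]
  have hRu : ∀ i j, ¬ p i → p j → (R * u) i j = 0 := by
    intro i j hi hj
    rw [mul_apply]
    refine Finset.sum_eq_zero fun k _ => ?_
    by_cases hk : p k
    · rw [hz R hR i k hi hk, zero_mul]
    · rw [hup k j hk hj, mul_zero]
  have h1 : ‖(u.toBlock p p).det‖ = 1 := by
    rw [norm_det_toBlock_eq_of_gram_eq p hup (Y := 1) (hz 1 blockTriangular_one) (by simpa using hu')]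
    simp
  have h2 := norm_det_toBlock_eq_of_gram_eq p hRu (hz R' hR') (by
    rw [← hgR', conjTranspose_mul, conjTranspose_mul, Matrix.mul_assoc, ← Matrix.mul_assoc Rᴴ,
      ← hgR]
    simp only [Matrix.mul_assoc])
  rw [hblock, det_mul, norm_mul, h1, mul_one] at h2
  have hdet : ∀ (T : Mat d) (c : Fin d → ℝ), T.BlockTriangular id → (∀ i, 0 < c i) →
      (∀ i, T i i = c i) → Real.log ‖(T.toBlock p p).det‖ = ∑ i with p i, Real.log (c i) := by
    intro T c hT hc hTc
    have ht : (T.toBlock p p).BlockTriangular id := fun i j hij => hT hij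
    rw [det_of_isUpperTriangular ht, norm_prod, Real.log_prod]
    · rw [Finset.sum_subtype (p := p) (F := inferInstance) _ (by simp)]
      simp [toBlock_apply, hTc, abs_of_pos (hc _)]
    · intro i _
      simp [toBlock_apply, hTc, (hc _).ne']
  have h3 := congrArg Real.log h2
  rw [hdet R a hR ha hRa, hdet R' a' hR' ha' hRa'] at h3
  simpa [hα, hα'] using h3

/-- The pairing of `α(g)` with a nonincreasing real diagonal matrix is invariant under right
multiplication of `g` by a unitary matrix commuting with the diagonal matrix. -/
theorem trace_diagonal_mul_iwaAlpha_mul_unitary {d : ℕ} {f : Fin d → ℝ} (hf : Antitone f)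
    {g u : Mat d} (hg : IsUnit g) (hu : u ∈ Matrix.unitaryGroup (Fin d) ℂ)
    (hfu : u * Matrix.diagonal (fun i => (f i : ℂ)) * star u
      = Matrix.diagonal (fun i => (f i : ℂ))) :
    Matrix.trace (Matrix.diagonal f * iwaAlpha g)
      = Matrix.trace (Matrix.diagonal f * iwaAlpha (g * u)) := by
  have hcomm : u * diagonal (fun i => (f i : ℂ)) = diagonal (fun i => (f i : ℂ)) * u := by
    conv_rhs => rw [← hfu]
    rw [Matrix.mul_assoc _ (star u), mem_unitaryGroup_iff'.1 hu, Matrix.mul_one]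
  have hzero : ∀ i j, f i ≠ f j → u i j = 0 := by
    intro i j hij
    have h := congrFun (congrFun hcomm i) j
    rw [mul_diagonal, diagonal_mul, mul_comm] at h
    by_contra h0
    exact hij (Complex.ofReal_injective (mul_right_cancel₀ h0 h)).symm
  have hfiber : ∀ c : ℝ, ∑ i with f i = c, iwaAlpha g i i
      = ∑ i with f i = c, iwaAlpha (g * u) i i := by
    intro c
    have hle := sum_iwaAlpha_mul_unitary hg hu (fun i => c ≤ f i)
      (fun i j hij hj => le_trans hj (hf hij))
      (fun i j hi hj => hzero i j fun h => hi (h ▸ hj))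
    have hlt := sum_iwaAlpha_mul_unitary hg hu (fun i => c < f i)
      (fun i j hij hj => lt_of_lt_of_le hj (hf hij))
      (fun i j hi hj => hzero i j fun h => hi (h ▸ hj))
    have hsplit : ∀ l : Fin d → ℝ, ∑ i with c ≤ f i, l i
        = ∑ i with f i = c, l i + ∑ i with c < f i, l i := by
      intro l
      simp only [Finset.sum_filter, ← Finset.sum_add_distrib]
      refine Finset.sum_congr rfl fun i _ => ?_
      rcases lt_trichotomy c (f i) with h | h | h
      · simp [h, h.le, h.ne']
      · simp [h]
      · simp [h.not_ge, h.ne, h.not_gt]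
    rw [hsplit, hsplit] at hle
    linarith
  have htrace : ∀ A : Matrix (Fin d) (Fin d) ℝ, trace (diagonal f * A)
      = ∑ c ∈ Finset.univ.image f, c * ∑ i with f i = c, A i i := by
    intro A
    simp only [trace, diag_apply, diagonal_mul]
    rw [← Finset.sum_fiberwise_of_maps_to
      (fun i _ => Finset.mem_image_of_mem f (Finset.mem_univ i))]
    refine Finset.sum_congr rfl fun c _ => ?_
    rw [Finset.mul_sum]
    refine Finset.sum_congr rfl fun i hi => ?_
    rw [(Finset.mem_filter.1 hi).2]
  rw [htrace, htrace]
  simp only [hfiber]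

theorem stmt2 (d : ℕ) (hd : 1 ≤ d) (f : Fin d → ℝ) (hf : Antitone f) :
    (∀ g : GL (Fin d) ℂ, ∀ u : Mat d, u ∈ Matrix.unitaryGroup (Fin d) ℂ →
      u * Matrix.diagonal (fun i => (f i : ℂ)) * star u = Matrix.diagonal (fun i => (f i : ℂ)) →
      Matrix.trace (Matrix.diagonal f * iwaAlpha (↑g : Mat d))
        = Matrix.trace (Matrix.diagonal f * iwaAlpha ((↑g : Mat d) * u)))
    ∧ (∀ g : GL (Fin d) ℂ, ∀ h₁ h₂ : Mat d, h₁ ∈ Matrix.unitaryGroup (Fin d) ℂ →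
      h₂ ∈ Matrix.unitaryGroup (Fin d) ℂ →
      h₁ * Matrix.diagonal (fun i => (f i : ℂ)) * star h₁
        = h₂ * Matrix.diagonal (fun i => (f i : ℂ)) * star h₂ →
      Matrix.trace (Matrix.diagonal f * iwaAlpha ((↑g : Mat d) * h₁))
        = Matrix.trace (Matrix.diagonal f * iwaAlpha ((↑g : Mat d) * h₂))) := by
  refine ⟨fun g u hu hfu => trace_diagonal_mul_iwaAlpha_mul_unitary hf g.isUnit hu hfu, ?_⟩
  intro g h₁ h₂ hh₁ hh₂ h
  have h11 : h₁ * star h₁ = 1 := mem_unitaryGroup_iff.1 hh₁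
  have h11' : star h₁ * h₁ = 1 := mem_unitaryGroup_iff'.1 hh₁
  have hgh : IsUnit ((g : Mat d) * h₁) := g.isUnit.mul (IsUnit.of_mul_eq_one_right _ h11')
  have hu : star h₁ * h₂ ∈ Matrix.unitaryGroup (Fin d) ℂ := mul_mem (Unitary.star_mem hh₁) hh₂
  have key := trace_diagonal_mul_iwaAlpha_mul_unitary hf hgh hu (by
    calc star h₁ * h₂ * diagonal (fun i => (f i : ℂ)) * star (star h₁ * h₂)
        = star h₁ * (h₂ * diagonal (fun i => (f i : ℂ)) * star h₂) * h₁ := by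
          rw [star_mul, star_star]
          simp only [Matrix.mul_assoc]
      _ = (star h₁ * h₁) * diagonal (fun i => (f i : ℂ)) * (star h₁ * h₁) := by
          rw [← h]
          simp only [Matrix.mul_assoc]
      _ = _ := by rw [h11', Matrix.one_mul, Matrix.mul_one])
  rw [key, Matrix.mul_assoc, ← Matrix.mul_assoc h₁, h11, Matrix.one_mul]

end
end

section
/- Let ρ be a positive semidefinite d×d complex matrix. Then the function n ↦ Tr(n* ρ n), restricted to the set of upper triangular complex matrices whose diagonal entries are all equal to 1, attains its infimum: there exists a unit upper triangular n₀ with Tr(n₀* ρ n₀) ≤ Tr(n* ρ n) for all unit upper triangular n. -/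
open Matrix
open scoped ComplexOrder

noncomputable section
open scoped Classical

/-- A positive semidefinite matrix is of the form `Bᴴ * B`. -/
theorem Matrix.PosSemidef.exists_eq_conjTranspose_mul_self {d : ℕ} {ρ : Mat d}
    (hρ : ρ.PosSemidef) : ∃ B : Mat d, ρ = Bᴴ * B := by
  open scoped MatrixOrder Matrix.Norms.L2Operator in
  exact CStarAlgebra.nonneg_iff_eq_star_mul_self.mp hρ.nonneg

/-- The strictly upper triangular matrices, as a subspace. -/
def strictlyUpperTriangular (d : ℕ) : Submodule ℂ (Mat d) where
  carrier := {t | ∀ i j, j ≤ i → t i j = 0}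
  zero_mem' := by simp
  add_mem' ha hb i j hij := by simp [ha i j hij, hb i j hij]
  smul_mem' c t ht i j hij := by simp [ht i j hij]

theorem isUnitUpperTriangular_iff_one_sub_mem {d : ℕ} {n : Mat d} :
    IsUnitUpperTriangular n ↔ 1 - n ∈ strictlyUpperTriangular d := by
  constructor
  · rintro ⟨hn, hdiag⟩ i j hij
    rcases hij.eq_or_lt with rfl | h
    · simp [hdiag]
    · simp [Matrix.one_apply_ne h.ne', hn h]
  · intro h
    refine ⟨fun i j hij => ?_, fun i => ?_⟩
    · simpa [Matrix.one_apply_ne (show j < i from hij).ne'] using h i j (show j < i from hij).le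
    · exact (sub_eq_zero.mp (by simpa using h i i le_rfl)).symm

section Frobenius

attribute [local instance] Matrix.frobeniusNormedAddCommGroup Matrix.frobeniusNormedSpace

theorem Matrix.re_trace_conjTranspose_mul_self {d : ℕ} (A : Mat d) :
    (Matrix.trace (Aᴴ * A)).re = ‖A‖ ^ 2 := by
  rw [Matrix.frobenius_norm_def, ← Real.sqrt_eq_rpow, Real.sq_sqrt (by positivity),
    Finset.sum_comm]
  simp [Matrix.trace, Matrix.mul_apply, ← Complex.normSq_eq_norm_sq, Complex.normSq_apply]

theorem exists_isUnitUpperTriangular_re_trace_le {d : ℕ} (B : Mat d) :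
    ∃ n₀ : Mat d, IsUnitUpperTriangular n₀ ∧
      ∀ n : Mat d, IsUnitUpperTriangular n →
        (Matrix.trace ((B * n₀)ᴴ * (B * n₀))).re ≤ (Matrix.trace ((B * n)ᴴ * (B * n))).re := by
  simp only [Matrix.re_trace_conjTranspose_mul_self]
  let K := (strictlyUpperTriangular d).map (LinearMap.mulLeft ℂ B)
  have : ProperSpace (Mat d) := FiniteDimensional.proper ℂ _
  obtain ⟨_, ⟨t, ht, rfl⟩, hmin⟩ :=
    K.closed_of_finiteDimensional.exists_infDist_eq_dist ⟨0, K.zero_mem⟩ B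
  refine ⟨1 - t, isUnitUpperTriangular_iff_one_sub_mem.mpr (by simpa using ht), fun n hn => ?_⟩
  have h := Metric.infDist_le_dist_of_mem (x := B)
    (Submodule.mem_map_of_mem (f := LinearMap.mulLeft ℂ B)
      (isUnitUpperTriangular_iff_one_sub_mem.mp hn))
  have h' := hmin.symm.trans_le h
  gcongr
  simpa [dist_eq_norm, mul_sub] using h'

end Frobenius

theorem stmt6 (d : ℕ) (hd : 1 ≤ d) (ρ : Mat d) (hρ : ρ.PosSemidef) :
    ∃ n₀ : Mat d, IsUnitUpperTriangular n₀ ∧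
      ∀ n : Mat d, IsUnitUpperTriangular n →
        (Matrix.trace (star n₀ * ρ * n₀)).re ≤ (Matrix.trace (star n * ρ * n)).re := by
  obtain ⟨B, rfl⟩ := hρ.exists_eq_conjTranspose_mul_self
  obtain ⟨n₀, hn₀, hmin⟩ := exists_isUnitUpperTriangular_re_trace_le B
  refine ⟨n₀, hn₀, fun n hn => ?_⟩
  have key (m : Mat d) : star m * (Bᴴ * B) * m = (B * m)ᴴ * (B * m) := by
    simp [Matrix.star_eq_conjTranspose, Matrix.mul_assoc]
  simpa only [key] using hmin n hn

end
end

section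
/- Let σ be a positive definite d×d complex matrix and let Δ_i(σ) denote its i-th leading principal minor (the determinant of the upper-left i×i submatrix), with Δ₀(σ) = 1. Then for every unit upper triangular matrix n one has Tr(n* σ n) ≥ Σ_{i=1}^d Δ_i(σ)/Δ_{i−1}(σ), and there exists a unit upper triangular n for which equality holds (namely one making n* σ n diagonal with diagonal entries Δ_i(σ)/Δ_{i−1}(σ)). -/
open Matrix
open scoped ComplexOrder

noncomputable section
open scoped Classical

/-- The `i`-th leading principal minor of `σ`: the determinant of the upper-left `i × i`
submatrix, with `Δ₀(σ) = 1`. -/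
def leadingMinor {d : ℕ} (σ : Mat d) (i : ℕ) (hi : i ≤ d) : ℂ :=
  Matrix.det (Matrix.of fun a b : Fin i => σ (Fin.castLE hi a) (Fin.castLE hi b))

theorem Matrix.BlockTriangular.submatrix_castLE_mul {d i : ℕ} {ι : Type*} (hi : i ≤ d)
    (A : Matrix ι (Fin d) ℂ) {n : Mat d} (hn : n.BlockTriangular (id : Fin d → Fin d)) :
    (A * n).submatrix id (Fin.castLE hi) =
      A.submatrix id (Fin.castLE hi) * n.submatrix (Fin.castLE hi) (Fin.castLE hi) := by
  ext a b
  simp only [submatrix_apply, mul_apply, id]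
  symm
  refine Fintype.sum_of_injective (Fin.castLE hi) (Fin.castLE_injective hi) _ _ ?_ fun _ => rfl
  intro k hk
  have hik : i ≤ (k : ℕ) := by
    by_contra! h
    exact hk ⟨⟨k, h⟩, rfl⟩
  have hbk : Fin.castLE hi b < k := by
    rw [Fin.lt_def, Fin.val_castLE]
    exact b.isLt.trans_le hik
  exact mul_eq_zero_of_right _ (hn hbk)

theorem IsUnitUpperTriangular.det_submatrix_castLE {d i : ℕ} (hi : i ≤ d) {n : Mat d}
    (hn : IsUnitUpperTriangular n) :
    (n.submatrix (Fin.castLE hi) (Fin.castLE hi)).det = 1 := by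
  have hup : (n.submatrix (Fin.castLE hi) (Fin.castLE hi)).IsUpperTriangular :=
    fun a b hab => hn.1 (by exact hab)
  rw [det_of_isUpperTriangular hup]
  exact Finset.prod_eq_one fun a _ => hn.2 _

/-- Congruence by a unit upper triangular matrix preserves the leading principal minors. -/
theorem leadingMinor_star_mul_mul {d i : ℕ} (hi : i ≤ d) (σ : Mat d) {n : Mat d}
    (hn : IsUnitUpperTriangular n) :
    leadingMinor (star n * σ * n) i hi = leadingMinor σ i hi := by
  have key : (star n * σ * n).submatrix (Fin.castLE hi) (Fin.castLE hi) =
      (n.submatrix (Fin.castLE hi) (Fin.castLE hi))ᴴ *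
        σ.submatrix (Fin.castLE hi) (Fin.castLE hi) *
        n.submatrix (Fin.castLE hi) (Fin.castLE hi) := by
    have h₁ := congrArg (fun M => M.submatrix (Fin.castLE hi) id)
      (BlockTriangular.submatrix_castLE_mul hi (star n * σ) hn.1)
    have h₂ := congrArg conjTranspose (BlockTriangular.submatrix_castLE_mul hi
      ((σ.submatrix id (Fin.castLE hi))ᴴ) hn.1)
    simp only [conjTranspose_submatrix, conjTranspose_mul, conjTranspose_conjTranspose,
      submatrix_submatrix] at h₂
    have h₃ : (star n * σ).submatrix (Fin.castLE hi) (Fin.castLE hi) =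
        (nᴴ * σ.submatrix id (Fin.castLE hi)).submatrix (Fin.castLE hi) id := rfl
    calc _ = (star n * σ).submatrix (Fin.castLE hi) (Fin.castLE hi) *
          n.submatrix (Fin.castLE hi) (Fin.castLE hi) := h₁
      _ = _ := by
        rw [h₃, h₂]
        rfl
  have hdet := hn.det_submatrix_castLE hi
  change det ((star n * σ * n).submatrix (Fin.castLE hi) (Fin.castLE hi)) =
    det (σ.submatrix (Fin.castLE hi) (Fin.castLE hi))
  rw [key, det_mul, det_mul, det_conjTranspose, hdet, star_one, one_mul, mul_one]

theorem leadingMinor_diagonal {d i : ℕ} (hi : i ≤ d) (D : Fin d → ℂ) :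
    leadingMinor (diagonal D) i hi = ∏ a : Fin i, D (Fin.castLE hi a) := by
  change det ((diagonal D).submatrix (Fin.castLE hi) (Fin.castLE hi)) = _
  rw [submatrix_diagonal _ _ (Fin.castLE_injective hi), det_diagonal]
  rfl

theorem leadingMinor_diagonal_succ {d : ℕ} (D : Fin d → ℂ) (i : Fin d) :
    leadingMinor (diagonal D) (i + 1) i.isLt =
      leadingMinor (diagonal D) i (le_of_lt i.isLt) * D i := by
  rw [leadingMinor_diagonal, leadingMinor_diagonal, Fin.prod_univ_castSucc]
  rfl

theorem leadingMinor_pos {d i : ℕ} (hi : i ≤ d) {σ : Mat d} (hσ : σ.PosDef) :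
    0 < leadingMinor σ i hi :=
  (hσ.submatrix (Fin.castLE_injective hi)).det_pos

theorem Matrix.BlockTriangular.mul_apply_self {d : ℕ} {A B : Mat d}
    (hA : A.BlockTriangular (id : Fin d → Fin d)) (hB : B.BlockTriangular (id : Fin d → Fin d))
    (i : Fin d) : (A * B) i i = A i i * B i i := by
  rw [mul_apply]
  refine Finset.sum_eq_single i (fun k _ hk => ?_) (by simp)
  rcases lt_or_gt_of_ne hk with h | h
  · rw [hA h, zero_mul]
  · rw [hB h, mul_zero]

/-- A positive definite matrix is diagonalised by congruence with a unit upper triangular one. -/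
theorem exists_isUnitUpperTriangular_star_mul_mul_eq_diagonal {d : ℕ} {σ : Mat d}
    (hσ : σ.PosDef) :
    ∃ n : Mat d, IsUnitUpperTriangular n ∧ ∃ D : Fin d → ℂ, star n * σ * n = diagonal D := by
  have hlow : (LDL.lowerInv hσ).IsLowerTriangular := fun i j hij =>
    LDL.lowerInv_triangular hσ (by exact hij)
  have hdet : (LDL.lowerInv hσ).det ≠ 0 := (isUnit_det_of_invertible _).ne_zero
  rw [det_of_isLowerTriangular _ hlow, Finset.prod_ne_zero_iff] at hdet
  set E : Fin d → ℂ := fun i => (star (LDL.lowerInv hσ i i))⁻¹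
  have hup : (LDL.lowerInv hσ)ᴴ.BlockTriangular (id : Fin d → Fin d) := fun i j hij => by
    rw [conjTranspose_apply, LDL.lowerInv_triangular hσ (by exact hij), star_zero]
  refine ⟨(LDL.lowerInv hσ)ᴴ * diagonal E, ⟨hup.mul (blockTriangular_diagonal E), fun i => ?_⟩,
    fun i => star (E i) * (LDL.diagEntries hσ i * E i), ?_⟩
  · rw [mul_diagonal, conjTranspose_apply]
    exact mul_inv_cancel₀ (star_ne_zero.mpr (hdet i (Finset.mem_univ i)))
  · have h := LDL.diag_eq_lowerInv_conj hσ
    calc _ = (diagonal E)ᴴ * (LDL.lowerInv hσ * σ * (LDL.lowerInv hσ)ᴴ) * diagonal E := by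
          rw [star_eq_conjTranspose, conjTranspose_mul, conjTranspose_conjTranspose]
          simp only [Matrix.mul_assoc]
      _ = _ := by
          rw [← h, LDL.diag, diagonal_conjTranspose, diagonal_mul_diagonal, diagonal_mul_diagonal]
          simp only [Pi.star_apply, mul_assoc]

/-- The diagonal form reached by a unit upper triangular congruence consists of the quotients of
consecutive leading principal minors. -/
theorem eq_ofReal_leadingMinor_div {d : ℕ} {σ n : Mat d} (hσ : σ.PosDef)
    (hn : IsUnitUpperTriangular n) {D : Fin d → ℂ} (hD : star n * σ * n = diagonal D)
    (i : Fin d) :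
    D i = (((leadingMinor σ (i + 1) i.isLt).re /
      (leadingMinor σ i (le_of_lt i.isLt)).re : ℝ) : ℂ) := by
  have h := leadingMinor_diagonal_succ D i
  rw [← hD, leadingMinor_star_mul_mul _ _ hn, leadingMinor_star_mul_mul _ _ hn] at h
  have h₀ := leadingMinor_pos (le_of_lt i.isLt) hσ
  have h₁ := leadingMinor_pos (show (i : ℕ) + 1 ≤ d from i.isLt) hσ
  rw [Complex.ofReal_div, ← Complex.eq_re_of_ofReal_le h₀.le, ← Complex.eq_re_of_ofReal_le h₁.le, h,
    mul_div_cancel_left₀ _ h₀.ne']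

/-- Changing a positive diagonal matrix by a unit upper triangular congruence does not decrease
its trace. -/
theorem sum_le_trace_star_mul_diagonal_mul {d : ℕ} {D : Fin d → ℝ} (hD : ∀ i, 0 ≤ D i)
    {m : Mat d} (hm : ∀ i, m i i = 1) :
    ∑ i, D i ≤ (trace (star m * diagonal (fun i => (D i : ℂ)) * m)).re := by
  rw [trace, Complex.re_sum]
  refine Finset.sum_le_sum fun i _ => ?_
  have h : (star m * diagonal (fun i => (D i : ℂ)) * m) i i =
      ((∑ k, D k * Complex.normSq (m k i) : ℝ) : ℂ) := by
    rw [mul_apply, Complex.ofReal_sum]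
    refine Finset.sum_congr rfl fun k _ => ?_
    rw [mul_diagonal, star_apply, Complex.ofReal_mul, Complex.normSq_eq_conj_mul_self,
      Complex.star_def]
    ring
  rw [diag_apply, h, Complex.ofReal_re]
  calc D i = D i * Complex.normSq (m i i) := by rw [hm, Complex.normSq_one, mul_one]
    _ ≤ _ := Finset.single_le_sum (f := fun k => D k * Complex.normSq (m k i))
      (fun k _ => mul_nonneg (hD k) (Complex.normSq_nonneg _)) (Finset.mem_univ i)

theorem stmt7 (d : ℕ) (hd : 1 ≤ d) (σ : Mat d) (hσ : σ.PosDef) :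
    (∀ n : Mat d, IsUnitUpperTriangular n →
      ∑ i : Fin d, (leadingMinor σ (i + 1) i.isLt).re / (leadingMinor σ i (le_of_lt i.isLt)).re
        ≤ (Matrix.trace (star n * σ * n)).re)
    ∧ ∃ n : Mat d, IsUnitUpperTriangular n ∧
        star n * σ * n = Matrix.diagonal (fun i : Fin d =>
          (((leadingMinor σ (i + 1) i.isLt).re / (leadingMinor σ i (le_of_lt i.isLt)).re : ℝ) : ℂ)) ∧
        (Matrix.trace (star n * σ * n)).re
          = ∑ i : Fin d, (leadingMinor σ (i + 1) i.isLt).re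
              / (leadingMinor σ i (le_of_lt i.isLt)).re := by
  obtain ⟨n₀, hn₀, D, hD⟩ := exists_isUnitUpperTriangular_star_mul_mul_eq_diagonal hσ
  obtain rfl : D = _ := funext (eq_ofReal_leadingMinor_div hσ hn₀ hD)
  refine ⟨fun n hn => ?_, n₀, hn₀, hD, ?_⟩
  · have hdet : IsUnit n₀.det := by
      rw [det_of_isUpperTriangular hn₀.1, Finset.prod_eq_one fun a _ => hn₀.2 a]
      exact isUnit_one
    have := invertibleOfIsUnitDet n₀ hdet
    have hm : (n₀⁻¹ * n).BlockTriangular (id : Fin d → Fin d) :=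
      (blockTriangular_inv_of_blockTriangular hn₀.1).mul hn.1
    have hn_eq : n₀ * (n₀⁻¹ * n) = n := mul_nonsing_inv_cancel_left _ _ hdet
    have hm_diag : ∀ i, (n₀⁻¹ * n) i i = 1 := fun i => by
      have h := hn₀.1.mul_apply_self hm i
      rwa [hn_eq, hn.2, hn₀.2, one_mul, eq_comm] at h
    have hle := sum_le_trace_star_mul_diagonal_mul (fun i : Fin d => div_nonneg
      (Complex.le_def.mp (leadingMinor_pos (show (i : ℕ) + 1 ≤ d from i.isLt) hσ).le).1
      (Complex.le_def.mp (leadingMinor_pos (le_of_lt i.isLt) hσ).le).1) hm_diag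
    have hconj : star (n₀⁻¹ * n) * (star n₀ * σ * n₀) * (n₀⁻¹ * n) = star n * σ * n := by
      conv_rhs => rw [← hn_eq, star_mul]
      simp only [mul_assoc]
    rw [← hconj, hD]
    exact hle
  · rw [hD, trace_diagonal, Complex.re_sum]
    rfl

end
end

section
/- Let ρ be a d×d density matrix (positive semidefinite with trace 1). Then I_ρ(x) ≥ 0 for every Hermitian d×d matrix x, and I_ρ(x) > 0 whenever x ≠ ρ. (For the standard representation of U(d) the moment map sends the state ρ to itself, so ρ is the unique possible zero of I_ρ.) -/
open Matrix
open scoped ComplexOrder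

noncomputable section
open scoped Classical

/-- `x = h * diagonal f * h*` with `h` unitary and `f` real and nonincreasing. -/
def IsOrderedDiagonalization {d : ℕ} (x : Mat d) (h : Mat d) (f : Fin d → ℝ) : Prop :=
  h ∈ Matrix.unitaryGroup (Fin d) ℂ ∧ Antitone f ∧
    x = h * Matrix.diagonal (fun i => (f i : ℂ)) * star h

/-- A choice of an ordered spectral decomposition `x = h x₀ h*` of a hermitian matrix. -/
def specPair {d : ℕ} (x : Mat d) : Mat d × (Fin d → ℝ) :=
  if h : ∃ p : Mat d × (Fin d → ℝ), IsOrderedDiagonalization x p.1 p.2 then h.choose else (1, 0)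

/-- `χ_x(g) = exp (2 Tr (x₀ α(g h)))` where `x = h x₀ h*` (independent of the choice of `h`). -/
def chi {d : ℕ} (x g : Mat d) : ℝ :=
  Real.exp (2 * Matrix.trace (Matrix.diagonal (specPair x).2 * iwaAlpha (g * (specPair x).1)))

/-- The rate function `I_ρ(x) = sup_{g ∈ GL(d,ℂ)} (-ln χ_x(g⁻¹) - ln Tr(g* ρ g))`,
with values in `(-∞, ∞]`. -/
def rate {d : ℕ} (ρ x : Mat d) : EReal :=
  ⨆ g : GL (Fin d) ℂ,
    ((- Real.log (chi x (↑g⁻¹ : Mat d))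
      - Real.log ((Matrix.trace (star (↑g : Mat d) * ρ * (↑g : Mat d))).re) : ℝ) : EReal)

theorem IsUnitUpperTriangular.det_eq_one {d : ℕ} {n : Mat d} (hn : IsUnitUpperTriangular n) :
    n.det = 1 := by
  rw [Matrix.det_of_isUpperTriangular hn.1]
  exact Finset.prod_eq_one fun i _ => hn.2 i

theorem IsUnitUpperTriangular.isUnit_det {d : ℕ} {n : Mat d} (hn : IsUnitUpperTriangular n) :
    IsUnit n.det := by
  rw [hn.det_eq_one]
  exact isUnit_one

theorem Matrix.BlockTriangular.mul_apply_diag {d : ℕ} {m n : Mat d}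
    (hm : m.BlockTriangular (id : Fin d → Fin d)) (hn : n.BlockTriangular (id : Fin d → Fin d))
    (i : Fin d) : (m * n) i i = m i i * n i i := by
  rw [Matrix.mul_apply]
  refine Finset.sum_eq_single i (fun k _ hk => ?_) (by simp)
  rcases lt_or_gt_of_ne hk with h | h
  · rw [hm h, zero_mul]
  · rw [hn h, mul_zero]

theorem IsUnitUpperTriangular.mul {d : ℕ} {m n : Mat d} (hm : IsUnitUpperTriangular m)
    (hn : IsUnitUpperTriangular n) : IsUnitUpperTriangular (m * n) :=
  ⟨hm.1.mul hn.1, fun i => by rw [hm.1.mul_apply_diag hn.1, hm.2, hn.2, mul_one]⟩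

theorem IsUnitUpperTriangular.inv {d : ℕ} {n : Mat d} (hn : IsUnitUpperTriangular n) :
    IsUnitUpperTriangular n⁻¹ := by
  have : Invertible n := Matrix.invertibleOfIsUnitDet n hn.isUnit_det
  have ht := Matrix.blockTriangular_inv_of_blockTriangular hn.1
  refine ⟨ht, fun i => ?_⟩
  have h := hn.1.mul_apply_diag ht i
  rw [Matrix.mul_nonsing_inv n hn.isUnit_det, hn.2, one_mul, Matrix.one_apply_eq] at h
  exact h.symm

theorem gram_eq_of_isIwasawa {d : ℕ} {g k n : Mat d} {f : Fin d → ℝ}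
    (hk : k ∈ Matrix.unitaryGroup (Fin d) ℂ)
    (hg : g = k * Matrix.diagonal (fun i => (f i : ℂ)) * n) :
    star g * g = star n * Matrix.diagonal (fun i => (f i : ℂ) ^ 2) * n := by
  have hk' : star k * k = 1 := (Matrix.mem_unitaryGroup_iff').1 hk
  have hD : star (Matrix.diagonal (fun i => (f i : ℂ))) = Matrix.diagonal (fun i => (f i : ℂ)) := by
    rw [Matrix.star_eq_conjTranspose, Matrix.diagonal_conjTranspose]
    congr 1
    ext i
    simp
  have hDD : Matrix.diagonal (fun i => (f i : ℂ) ^ 2)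
      = Matrix.diagonal (fun i => (f i : ℂ)) * Matrix.diagonal (fun i => (f i : ℂ)) := by
    rw [Matrix.diagonal_mul_diagonal]
    simp only [pow_two]
  rw [hg, star_mul, star_mul, hD, hDD]
  simp only [mul_assoc]
  rw [← mul_assoc (star k) k, hk', one_mul]

theorem isIwasawa_diag_unique {d : ℕ} {g k k' n n' : Mat d} {f f' : Fin d → ℝ}
    (hf : ∀ i, 0 < f i) (hf' : ∀ i, 0 < f' i)
    (hk : k ∈ Matrix.unitaryGroup (Fin d) ℂ) (hk' : k' ∈ Matrix.unitaryGroup (Fin d) ℂ)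
    (hn : IsUnitUpperTriangular n) (hn' : IsUnitUpperTriangular n')
    (hg : g = k * Matrix.diagonal (fun i => (f i : ℂ)) * n)
    (hg' : g = k' * Matrix.diagonal (fun i => (f' i : ℂ)) * n') : f = f' := by
  have h := (gram_eq_of_isIwasawa hk hg).symm.trans (gram_eq_of_isIwasawa hk' hg')
  have h1 : star n⁻¹ * star n = 1 := by
    rw [← star_mul, Matrix.mul_nonsing_inv n hn.isUnit_det, star_one]
  have h2 : Matrix.diagonal (fun i => (f i : ℂ) ^ 2) * (n * n'⁻¹)
      = star (n' * n⁻¹) * Matrix.diagonal (fun i => (f' i : ℂ) ^ 2) := by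
    have h3 := congrArg (fun y => star n⁻¹ * y * n'⁻¹) h
    simp only [mul_assoc] at h3
    rw [← mul_assoc (star n⁻¹) (star n), h1, one_mul,
      Matrix.mul_nonsing_inv n' hn'.isUnit_det, mul_one] at h3
    rw [h3, star_mul, mul_assoc]
  ext i
  have h4 := congrFun (congrFun h2 i) i
  rw [Matrix.diagonal_mul, Matrix.mul_diagonal, (hn.mul hn'.inv).2, Matrix.star_apply,
    (hn'.mul hn.inv).2, star_one, mul_one, one_mul] at h4
  norm_cast at h4
  exact (pow_left_inj₀ (hf i).le (hf' i).le two_ne_zero).1 h4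

theorem iwaAlpha_eq {d : ℕ} {g k n : Mat d} {f : Fin d → ℝ} (hf : ∀ i, 0 < f i)
    (hk : k ∈ Matrix.unitaryGroup (Fin d) ℂ) (hn : IsUnitUpperTriangular n)
    (hg : g = k * Matrix.diagonal (fun i => (f i : ℂ)) * n) :
    iwaAlpha g = Matrix.diagonal (fun i => Real.log (f i)) := by
  have hex : ∃ t : Mat d × Mat d × Mat d, IsIwasawa g t.1 t.2.1 t.2.2 :=
    ⟨(k, Matrix.diagonal (fun i => (f i : ℂ)), n), hg, hk, ⟨f, hf, rfl⟩, hn⟩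
  have ht : iwaTriple g = hex.choose := dif_pos hex
  obtain ⟨hg', hk', ⟨f', hf', ha'⟩, hn'⟩ := hex.choose_spec
  rw [← ht] at hg' hk' ha' hn'
  rw [ha'] at hg'
  have := isIwasawa_diag_unique hf hf' hk hk' hn hn' hg hg'
  subst this
  simp [iwaAlpha, ha']

theorem exists_isOrderedDiagonalization {d : ℕ} {x : Mat d} (hx : x.IsHermitian) :
    ∃ p : Mat d × (Fin d → ℝ), IsOrderedDiagonalization x p.1 p.2 := by
  set σ : Equiv.Perm (Fin d) := Tuple.sort (fun i => -hx.eigenvalues i)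
  set u : Mat d := (hx.eigenvectorUnitary : Matrix (Fin d) (Fin d) ℂ)
  have huu : u * star u = 1 := (Matrix.mem_unitaryGroup_iff).1 hx.eigenvectorUnitary.2
  refine ⟨(u.submatrix id σ, hx.eigenvalues ∘ σ), ?_, ?_, ?_⟩
  · rw [Matrix.mem_unitaryGroup_iff, Matrix.star_eq_conjTranspose, Matrix.conjTranspose_submatrix,
      Matrix.submatrix_mul_equiv, ← Matrix.star_eq_conjTranspose, huu, Matrix.submatrix_id_id]
  · intro i j hij
    exact neg_le_neg_iff.1 (Tuple.monotone_sort (fun i => -hx.eigenvalues i) hij)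
  · have hs := hx.spectral_theorem
    rw [Unitary.conjStarAlgAut_apply] at hs
    have hD : Matrix.diagonal (fun i => (((hx.eigenvalues ∘ σ) i : ℝ) : ℂ))
        = (Matrix.diagonal (fun i => ((hx.eigenvalues i : ℝ) : ℂ))).submatrix σ σ := by
      rw [Matrix.submatrix_diagonal_equiv]
      rfl
    dsimp only
    rw [hD, Matrix.star_eq_conjTranspose, Matrix.conjTranspose_submatrix,
      Matrix.submatrix_mul_equiv, Matrix.submatrix_mul_equiv, Matrix.submatrix_id_id]
    exact hs

theorem specPair_spec {d : ℕ} {x : Mat d} (hx : x.IsHermitian) :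
    IsOrderedDiagonalization x (specPair x).1 (specPair x).2 := by
  have h := exists_isOrderedDiagonalization hx
  rw [show specPair x = h.choose from dif_pos h]
  exact h.choose_spec

/-- The value of the functional defining `rate` at `g = h U h*`, where `h` diagonalizes `x` and
`U⁻¹ = diag(b) n` is upper triangular. -/
theorem le_rate {d : ℕ} (ρ : Mat d) {x U n : Mat d} {b : Fin d → ℝ}
    (hx : x.IsHermitian) (hb : ∀ i, 0 < b i) (hn : IsUnitUpperTriangular n)
    (hU : U * (Matrix.diagonal (fun i => (b i : ℂ)) * n) = 1) :
    ((-(2 * ∑ i, (specPair x).2 i * Real.log (b i)) - Real.log ((Matrix.trace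
      (star U * (star (specPair x).1 * ρ * (specPair x).1) * U)).re) : ℝ) : EReal)
      ≤ rate ρ x := by
  obtain ⟨hh, -, -⟩ := specPair_spec hx
  set h := (specPair x).1
  set V : Mat d := Matrix.diagonal (fun i => (b i : ℂ)) * n with hV
  have h1 : star h * h = 1 := (Matrix.mem_unitaryGroup_iff').1 hh
  have h2 : h * star h = 1 := (Matrix.mem_unitaryGroup_iff).1 hh
  have hconj : ∀ A B : Mat d, A * B = 1 → (h * A * star h) * (h * B * star h) = 1 := by
    intro A B hAB
    calc (h * A * star h) * (h * B * star h) = h * A * (star h * h) * B * star h := by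
          simp only [mul_assoc]
      _ = h * (A * B) * star h := by rw [h1]; simp only [mul_assoc, one_mul]
      _ = 1 := by rw [hAB, mul_one, h2]
  let g : GL (Fin d) ℂ := ⟨h * U * star h, h * V * star h, hconj U V hU,
    hconj V U (mul_eq_one_comm.1 hU)⟩
  have hg : ((g⁻¹ : GL (Fin d) ℂ) : Mat d) * h = h * Matrix.diagonal (fun i => (b i : ℂ)) * n := by
    change h * V * star h * h = _
    rw [mul_assoc, h1, mul_one, hV, mul_assoc]
  have hchi : Real.log (chi x (↑g⁻¹ : Mat d)) = 2 * ∑ i, (specPair x).2 i * Real.log (b i) := by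
    rw [chi, Real.log_exp, iwaAlpha_eq hb hh hn hg, Matrix.diagonal_mul_diagonal,
      Matrix.trace_diagonal]
  have htr : Matrix.trace (star (↑g : Mat d) * ρ * (↑g : Mat d))
      = Matrix.trace (star U * (star h * ρ * h) * U) := by
    change Matrix.trace (star (h * U * star h) * ρ * (h * U * star h)) = _
    rw [star_mul, star_mul, star_star, ← mul_assoc, Matrix.trace_mul_comm]
    simp only [← mul_assoc]
    rw [h1, one_mul]
  rw [← hchi, ← htr]
  exact le_iSup (fun g : GL (Fin d) ℂ =>
    ((- Real.log (chi x (↑g⁻¹ : Mat d))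
      - Real.log ((Matrix.trace (star (↑g : Mat d) * ρ * (↑g : Mat d))).re) : ℝ) : EReal)) g

theorem rate_nonneg {d : ℕ} {ρ x : Mat d} (hρ : Matrix.trace ρ = 1) (hx : x.IsHermitian) :
    0 ≤ rate ρ x := by
  have h := le_rate ρ (U := 1) (n := 1) (b := 1) hx (fun _ => zero_lt_one)
    ⟨Matrix.blockTriangular_one, fun _ => Matrix.one_apply_eq _⟩ (by simp)
  have h2 := (Matrix.mem_unitaryGroup_iff).1 (specPair_spec hx).1
  rw [star_one, one_mul, mul_one, Matrix.trace_mul_comm, ← mul_assoc, h2, one_mul, hρ] at h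
  simpa using h

/-- Criticality along the diagonal directions. -/
theorem diag_eq_of_rate_nonpos {d : ℕ} {ρ x : Mat d} (hx : x.IsHermitian)
    (hρ : Matrix.trace ρ = 1) (hr : rate ρ x ≤ 0) (i : Fin d) :
    ((star (specPair x).1 * ρ * (specPair x).1) i i).re = (specPair x).2 i := by
  have htr : Matrix.trace (star (specPair x).1 * ρ * (specPair x).1) = 1 := by
    rw [Matrix.trace_mul_comm, ← mul_assoc,
      (Matrix.mem_unitaryGroup_iff).1 (specPair_spec hx).1, one_mul, hρ]
  set σ := star (specPair x).1 * ρ * (specPair x).1 with hσ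
  set f := (specPair x).2
  have key : ∀ t : ℝ, 0 ≤ Real.log (1 + (Real.exp (2 * t) - 1) * (σ i i).re) - 2 * f i * t := by
    intro t
    set s : Fin d → ℝ := Pi.single i t with hs
    have h := (le_rate ρ (U := Matrix.diagonal (fun k => (Real.exp (s k) : ℂ))) (n := 1)
      (b := fun k => Real.exp (-s k)) hx (fun _ => Real.exp_pos _)
      ⟨Matrix.blockTriangular_one, fun _ => Matrix.one_apply_eq _⟩ (by
        rw [mul_one, Matrix.diagonal_mul_diagonal, ← Matrix.diagonal_one]
        congr 1
        ext k
        rw [← Complex.ofReal_mul, ← Real.exp_add]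
        simp)).trans hr
    rw [← hσ] at h
    have h1 : ∑ k, f k * Real.log (Real.exp (-s k)) = -(f i * t) := by
      simp [hs, Pi.single_apply]
    have h2 : (Matrix.trace (star (Matrix.diagonal (fun k => (Real.exp (s k) : ℂ))) * σ *
        Matrix.diagonal (fun k => (Real.exp (s k) : ℂ)))).re
        = 1 + (Real.exp (2 * t) - 1) * (σ i i).re := by
      have h3 : ∑ k, (σ k k).re = 1 := by
        have := congrArg Complex.re htr
        simpa [Matrix.trace] using this
      rw [← sub_eq_iff_eq_add', Matrix.star_eq_conjTranspose, Matrix.diagonal_conjTranspose,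
        Matrix.trace, Complex.re_sum]
      refine (congrArg _ h3.symm).trans ?_
      rw [← Finset.sum_sub_distrib, Finset.sum_eq_single i]
      · simp only [Matrix.diag_apply, Matrix.mul_diagonal, Matrix.diagonal_mul, Pi.star_apply, hs,
          Pi.single_eq_same, RCLike.star_def, Complex.conj_ofReal, Complex.re_mul_ofReal,
          Complex.re_ofReal_mul, two_mul, Real.exp_add]
        ring
      · intro k _ hk
        simp [Matrix.mul_diagonal, Matrix.diagonal_mul, hs, hk]
      · simp
    rw [h1, h2] at h
    have h' : -(2 * -(f i * t)) - Real.log (1 + (Real.exp (2 * t) - 1) * (σ i i).re) ≤ 0 := by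
      exact_mod_cast h
    linarith
  have hmin : IsLocalMin
      (fun t : ℝ => Real.log (1 + (Real.exp (2 * t) - 1) * (σ i i).re) - 2 * f i * t) 0 :=
    Filter.Eventually.of_forall fun t => by simpa using key t
  have hder : HasDerivAt
      (fun t : ℝ => Real.log (1 + (Real.exp (2 * t) - 1) * (σ i i).re) - 2 * f i * t)
      (2 * (σ i i).re - 2 * f i) 0 := by
    have h1 : HasDerivAt (fun t : ℝ => 1 + (Real.exp (2 * t) - 1) * (σ i i).re)
        (Real.exp (2 * 0) * (2 * 1) * (σ i i).re) 0 :=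
      (((((hasDerivAt_id (0 : ℝ)).const_mul 2).exp).sub_const 1).mul_const _).const_add 1
    have h2 := (h1.log (by simp)).fun_sub ((hasDerivAt_id (0 : ℝ)).const_mul (2 * f i))
    simpa using h2
  linarith [hmin.hasDerivAt_eq_zero hder]

/-- Criticality along the directions of the elementary nilpotent matrices. -/
theorem offDiag_eq_zero_of_rate_nonpos {d : ℕ} {ρ x : Mat d} (hx : x.IsHermitian)
    (hρ' : ρ.IsHermitian) (hρ : Matrix.trace ρ = 1) (hr : rate ρ x ≤ 0) {i j : Fin d}
    (hij : i < j) : (star (specPair x).1 * ρ * (specPair x).1) j i = 0 := by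
  have htr : Matrix.trace (star (specPair x).1 * ρ * (specPair x).1) = 1 := by
    rw [Matrix.trace_mul_comm, ← mul_assoc,
      (Matrix.mem_unitaryGroup_iff).1 (specPair_spec hx).1, one_mul, hρ]
  have hherm : (star (specPair x).1 * ρ * (specPair x).1).IsHermitian :=
    Matrix.isHermitian_conjTranspose_mul_mul _ hρ'
  set σ := star (specPair x).1 * ρ * (specPair x).1 with hσ
  set w := σ j i with hw
  have key : ∀ t : ℝ, 0 ≤ Real.log (1 + 2 * Complex.normSq w * t
      + Complex.normSq w * (σ i i).re * t ^ 2) := by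
    intro t
    set z : ℂ := t * star w with hz
    have hne : j ≠ i := hij.ne'
    have h := (le_rate ρ (U := 1 + Matrix.single i j z) (n := 1 + Matrix.single i j (-z))
      (b := 1) hx (fun _ => zero_lt_one)
      ⟨Matrix.blockTriangular_one.add (Matrix.blockTriangular_single hij.le _), fun k => by
        have : ¬(i = k ∧ j = k) := fun h => hij.ne (h.1.trans h.2.symm)
        simp [this]⟩ (by
        have h0 : Matrix.diagonal (fun k : Fin d => (((1 : Fin d → ℝ) k : ℝ) : ℂ)) = 1 := by
          simp
        rw [h0, one_mul, mul_add, add_mul, add_mul,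
          Matrix.single_mul_single_of_ne _ _ _ _ hne, mul_one, mul_one, one_mul, add_zero,
          add_assoc, ← Matrix.single_add, add_neg_cancel, Matrix.single_zero, add_zero])).trans hr
    rw [← hσ] at h
    have h2 : (Matrix.trace (star (1 + Matrix.single i j z) * σ *
        (1 + Matrix.single i j z))).re = 1 + 2 * Complex.normSq w * t
          + Complex.normSq w * (σ i i).re * t ^ 2 := by
      have hji : σ i j = star w := (hherm.apply i j).symm
      rw [Matrix.star_eq_conjTranspose, Matrix.conjTranspose_add, Matrix.conjTranspose_one,
        Matrix.conjTranspose_single, mul_add, mul_one, add_mul, add_mul, one_mul,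
        Matrix.single_mul_mul_single]
      simp only [Matrix.trace_add, htr, Matrix.trace_single_mul, Matrix.trace_mul_single,
        Matrix.trace_single_eq_same, hji, ← hw, hz]
      simp [Complex.normSq_apply]
      ring
    rw [h2] at h
    have h' : -(2 * ∑ k, (specPair x).2 k * Real.log ((1 : Fin d → ℝ) k)) -
        Real.log (1 + 2 * Complex.normSq w * t
          + Complex.normSq w * (σ i i).re * t ^ 2) ≤ 0 := by
      exact_mod_cast h
    simp only [Pi.one_apply, Real.log_one, mul_zero, Finset.sum_const_zero, neg_zero] at h'
    linarith
  have hmin : IsLocalMin (fun t : ℝ => Real.log (1 + 2 * Complex.normSq w * t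
      + Complex.normSq w * (σ i i).re * t ^ 2)) 0 :=
    Filter.Eventually.of_forall fun t => by simpa using key t
  have hder : HasDerivAt (fun t : ℝ => Real.log (1 + 2 * Complex.normSq w * t
      + Complex.normSq w * (σ i i).re * t ^ 2)) (2 * Complex.normSq w) 0 := by
    have h1 := (((hasDerivAt_id (0 : ℝ)).const_mul (2 * Complex.normSq w)).const_add 1).add
      (((hasDerivAt_id (0 : ℝ)).pow 2).const_mul (Complex.normSq w * (σ i i).re))
    have h2 := h1.log (by simp)
    simpa using h2
  have h0 := hmin.hasDerivAt_eq_zero hder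
  exact Complex.normSq_eq_zero.1 (by linarith)

theorem eq_of_rate_nonpos {d : ℕ} {ρ x : Mat d} (hx : x.IsHermitian)
    (hρ' : ρ.IsHermitian) (hρ : Matrix.trace ρ = 1) (hr : rate ρ x ≤ 0) : x = ρ := by
  obtain ⟨hh, -, hxe⟩ := specPair_spec hx
  have hherm : (star (specPair x).1 * ρ * (specPair x).1).IsHermitian :=
    Matrix.isHermitian_conjTranspose_mul_mul _ hρ'
  have hD : star (specPair x).1 * ρ * (specPair x).1
      = Matrix.diagonal (fun i => ((specPair x).2 i : ℂ)) := by
    ext i j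
    rcases lt_trichotomy i j with h | rfl | h
    · rw [← hherm.apply, offDiag_eq_zero_of_rate_nonpos hx hρ' hρ hr h, star_zero,
        Matrix.diagonal_apply_ne _ h.ne]
    · rw [Matrix.diagonal_apply_eq, ← diag_eq_of_rate_nonpos hx hρ hr i]
      exact (Complex.conj_eq_iff_re.1 (hherm.apply i i)).symm
    · rw [offDiag_eq_zero_of_rate_nonpos hx hρ' hρ hr h, Matrix.diagonal_apply_ne _ h.ne']
  have h2 : (specPair x).1 * star (specPair x).1 = 1 := (Matrix.mem_unitaryGroup_iff).1 hh
  rw [hxe, ← hD]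
  simp only [← mul_assoc]
  rw [h2, one_mul, mul_assoc, h2, mul_one]

theorem stmt11 (d : ℕ) (hd : 1 ≤ d) (ρ : Mat d) (hρ : ρ.PosSemidef)
    (hρ1 : Matrix.trace ρ = 1) :
    ∀ x : Mat d, x.IsHermitian →
      (0 : EReal) ≤ rate ρ x ∧ (x ≠ ρ → (0 : EReal) < rate ρ x) := by
  intro x hx
  exact ⟨rate_nonneg hρ1 hx, fun hne => lt_of_not_ge fun hr =>
    hne (eq_of_rate_nonpos hx hρ.isHermitian hρ1 hr)⟩

end
end
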